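/- For an abelian group M, let A(M) := (F_M ⊕ Q_M)/T_M as in the norm construction. Then for every homomorphism φ : M → L of abelian groups there is a unique group homomorphism A(φ) : A(M) → A(L) satisfying A(φ)[N_a] = [N_{φ(a)}] for all a ∈ M and A(φ)[x ⊗ y] = [φ(x) ⊗ φ(y)] for all x, y ∈ M. Moreover A(id_M) = id_{A(M)} and A(ψ ∘ φ) = A(ψ) ∘ A(φ) for composable homomorphisms φ, ψ. -/

import Mathlib

open scoped TensorProduct

universe u

/-- The subgroup of `M ⊗_ℤ M` generated by the elements `x ⊗ y - y ⊗ x`. -/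
noncomputable def symSub (M : Type u) [AddCommGroup M] : AddSubgroup (TensorProduct ℤ M M) :=
  AddSubgroup.closure {z | ∃ x y : M, z = x ⊗ₜ[ℤ] y - y ⊗ₜ[ℤ] x}

/-- `Q_M`: the quotient of `M ⊗_ℤ M` by the subgroup generated by `x ⊗ y - y ⊗ x`. -/
abbrev QGrp (M : Type u) [AddCommGroup M] :=
  TensorProduct ℤ M M ⧸ symSub M

/-- The Tambara reciprocity subgroup `T_M ≤ F_M ⊕ Q_M`, generated by the elements
`N_{a+b} - N_a - N_b - [a ⊗ b]`. -/
noncomputable def trSub (M : Type u) [AddCommGroup M] :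
    AddSubgroup (FreeAbelianGroup M × QGrp M) :=
  AddSubgroup.closure {z | ∃ a b : M,
    z = (FreeAbelianGroup.of (a + b) - FreeAbelianGroup.of a - FreeAbelianGroup.of b,
          -(QuotientAddGroup.mk (a ⊗ₜ[ℤ] b)))}

/-- `A(M) = (F_M ⊕ Q_M) / T_M`, the top level of the norm construction `N^{C₂}_e M`. -/
abbrev AGrp (M : Type u) [AddCommGroup M] :=
  (FreeAbelianGroup M × QGrp M) ⧸ trSub M

/-- The class `[N_a]` in `A(M)`. -/
noncomputable def Ncl {M : Type u} [AddCommGroup M] (a : M) : AGrp M :=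
  QuotientAddGroup.mk (FreeAbelianGroup.of a, 0)

/-- The class `[x ⊗ y]` in `A(M)`. -/
noncomputable def Tcl {M : Type u} [AddCommGroup M] (x y : M) : AGrp M :=
  QuotientAddGroup.mk (0, QuotientAddGroup.mk (x ⊗ₜ[ℤ] y))

noncomputable def tensMap {M L : Type u} [AddCommGroup M] [AddCommGroup L] (φ : M →+ L) :
    TensorProduct ℤ M M →+ TensorProduct ℤ L L :=
  (TensorProduct.map φ.toIntLinearMap φ.toIntLinearMap).toAddMonoidHom

theorem tensMap_tmul {M L : Type u} [AddCommGroup M] [AddCommGroup L] (φ : M →+ L) (x y : M) :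
    tensMap φ (x ⊗ₜ[ℤ] y) = φ x ⊗ₜ[ℤ] φ y := rfl

noncomputable def QMap {M L : Type u} [AddCommGroup M] [AddCommGroup L] (φ : M →+ L) :
    QGrp M →+ QGrp L :=
  QuotientAddGroup.map (symSub M) (symSub L) (tensMap φ) (by
    unfold symSub
    rw [AddSubgroup.closure_le]
    rintro z ⟨x, y, rfl⟩
    refine AddSubgroup.subset_closure ⟨φ x, φ y, ?_⟩
    rw [map_sub, tensMap_tmul, tensMap_tmul])

theorem QMap_mk {M L : Type u} [AddCommGroup M] [AddCommGroup L] (φ : M →+ L) (x y : M) :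
    QMap φ (QuotientAddGroup.mk (x ⊗ₜ[ℤ] y)) = QuotientAddGroup.mk (φ x ⊗ₜ[ℤ] φ y) := rfl

noncomputable def AMap {M L : Type u} [AddCommGroup M] [AddCommGroup L] (φ : M →+ L) :
    AGrp M →+ AGrp L :=
  QuotientAddGroup.map (trSub M) (trSub L)
    (AddMonoidHom.prodMap (FreeAbelianGroup.map φ) (QMap φ)) (by
    rw [trSub, AddSubgroup.closure_le]
    rintro z ⟨a, b, rfl⟩
    refine AddSubgroup.subset_closure ⟨φ a, φ b, ?_⟩
    simp only [AddMonoidHom.prodMap, AddMonoidHom.prod_apply, AddMonoidHom.comp_apply,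
      AddMonoidHom.coe_fst, AddMonoidHom.coe_snd, map_sub, map_neg, QMap_mk,
      FreeAbelianGroup.map_of_apply, map_add])

theorem AMap_Ncl {M L : Type u} [AddCommGroup M] [AddCommGroup L] (φ : M →+ L) (a : M) :
    AMap φ (Ncl a) = Ncl (φ a) := by
  change QuotientAddGroup.mk (FreeAbelianGroup.map φ (FreeAbelianGroup.of a), QMap φ 0) = _
  rw [FreeAbelianGroup.map_of_apply, map_zero]; rfl

theorem AMap_Tcl {M L : Type u} [AddCommGroup M] [AddCommGroup L] (φ : M →+ L) (x y : M) :
    AMap φ (Tcl x y) = Tcl (φ x) (φ y) := by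
  change QuotientAddGroup.mk (FreeAbelianGroup.map φ 0, QMap φ (QuotientAddGroup.mk (x ⊗ₜ[ℤ] y))) = _
  rw [map_zero, QMap_mk]; rfl

theorem AGrp_hom_ext {M : Type u} {P : Type*} [AddCommGroup M] [AddCommGroup P]
    (f g : AGrp M →+ P) (h1 : ∀ a, f (Ncl a) = g (Ncl a))
    (h2 : ∀ x y, f (Tcl x y) = g (Tcl x y)) : f = g := by
  have e1 : (f.comp (QuotientAddGroup.mk' (trSub M))).comp (AddMonoidHom.inl _ _) =
      (g.comp (QuotientAddGroup.mk' (trSub M))).comp (AddMonoidHom.inl _ _) :=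
    FreeAbelianGroup.lift_ext _ _ h1
  have e2 : ∀ t : TensorProduct ℤ M M,
      f (QuotientAddGroup.mk (0, QuotientAddGroup.mk t)) =
      g (QuotientAddGroup.mk (0, QuotientAddGroup.mk t)) := by
    let j : TensorProduct ℤ M M →+ AGrp M := (QuotientAddGroup.mk' (trSub M)).comp
      ((AddMonoidHom.inr _ _).comp (QuotientAddGroup.mk' (symSub M)))
    intro t
    change f (j t) = g (j t)
    induction t using TensorProduct.induction_on with
    | zero => simp only [map_zero]
    | tmul x y => exact h2 x y
    | add a b ha hb => simp only [map_add, ha, hb]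
  refine AddMonoidHom.ext fun z => ?_
  obtain ⟨⟨a, q⟩, rfl⟩ := QuotientAddGroup.mk_surjective z
  obtain ⟨t, rfl⟩ := QuotientAddGroup.mk_surjective q
  have h : (QuotientAddGroup.mk (a, QuotientAddGroup.mk t) : AGrp M) =
      QuotientAddGroup.mk (a, 0) + QuotientAddGroup.mk (0, QuotientAddGroup.mk t) := by
    rw [← QuotientAddGroup.mk_add, Prod.mk_add_mk, add_zero, zero_add]
  rw [h, map_add, map_add, e2]
  congr 1
  exact DFunLike.congr_fun e1 a

/-- Functoriality of the norm construction: every homomorphism `φ : M → L` induces a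
unique group homomorphism `A(φ) : A(M) → A(L)` with `A(φ)[N_a] = [N_{φ a}]` and
`A(φ)[x ⊗ y] = [φ x ⊗ φ y]`; moreover `A(id) = id` and `A(ψ ∘ φ) = A(ψ) ∘ A(φ)`. -/
theorem stmt_12 :
    ∃ Amap : ∀ (M L : Type u) [AddCommGroup M] [AddCommGroup L],
        (M →+ L) → (AGrp M →+ AGrp L),
      (∀ (M L : Type u) [AddCommGroup M] [AddCommGroup L] (φ : M →+ L),
        (∀ a : M, Amap M L φ (Ncl a) = Ncl (φ a)) ∧
        (∀ x y : M, Amap M L φ (Tcl x y) = Tcl (φ x) (φ y))) ∧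
      (∀ (M L : Type u) [AddCommGroup M] [AddCommGroup L] (φ : M →+ L)
          (g : AGrp M →+ AGrp L),
        (∀ a : M, g (Ncl a) = Ncl (φ a)) → (∀ x y : M, g (Tcl x y) = Tcl (φ x) (φ y)) →
        g = Amap M L φ) ∧
      (∀ (M : Type u) [AddCommGroup M],
        Amap M M (AddMonoidHom.id M) = AddMonoidHom.id (AGrp M)) ∧
      (∀ (M L P : Type u) [AddCommGroup M] [AddCommGroup L] [AddCommGroup P]
          (φ : M →+ L) (ψ : L →+ P),
        Amap M P (ψ.comp φ) = (Amap L P ψ).comp (Amap M L φ)) := by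
  refine ⟨fun M L _ _ φ => AMap φ, fun M L _ _ φ => ⟨AMap_Ncl φ, AMap_Tcl φ⟩, ?_, ?_, ?_⟩
  · intro M L _ _ φ g h1 h2
    exact AGrp_hom_ext _ _ (fun a => by rw [h1, AMap_Ncl]) (fun x y => by rw [h2, AMap_Tcl])
  · intro M _
    exact AGrp_hom_ext _ _ (fun a => AMap_Ncl _ a) (fun x y => AMap_Tcl _ x y)
  · intro M L P _ _ _ φ ψ
    refine AGrp_hom_ext _ _ (fun a => ?_) (fun x y => ?_)
    · rw [AddMonoidHom.comp_apply, AMap_Ncl, AMap_Ncl, AMap_Ncl]; rfl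
    · rw [AddMonoidHom.comp_apply, AMap_Tcl, AMap_Tcl, AMap_Tcl]; rfl
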